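/- Assume ν satisfies (N1) and (N2). Then there exists a constant c > 0 such that for all r, s > 0: ∫_{{y ∈ ℝ^d : |y| > r}} f̃( max(s,|y|) − |y|/2 ) ν(|y|) dy ≤ c f̃(s) Ψ(1/r) and ∫_{{y ∈ ℝ^{d+2} : |y| > r}} f( max(s,|y|) − |y|/2 ) ν₁(|y|) dy ≤ c f(s) Ψ(1/r). -/

import Mathlib

open MeasureTheory Filter Set

attribute [local instance] Classical.propDecidable

/-- `φ̂(r) = r² / ∫₀^r s^{d+1} ν(s) ds` for `0 < r ≤ 1`, and `φ̂(r) = φ̂(1) r²` for `r > 1`. -/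
noncomputable def phiHat (d : ℕ) (ν : ℝ → ℝ) (r : ℝ) : ℝ :=
  if r ≤ 1 then r ^ 2 / ∫ s in Set.Ioo (0:ℝ) r, s ^ (d + 1) * ν s
  else (1 / ∫ s in Set.Ioo (0:ℝ) 1, s ^ (d + 1) * ν s) * r ^ 2

/-- `ν₁(r) = -ν′(r) / (2π r)`. -/
noncomputable def nu1 (ν : ℝ → ℝ) (r : ℝ) : ℝ := -(deriv ν r) / (2 * Real.pi * r)

/-- The radial characteristic exponent of the symmetric Lévy measure `ν(|z|)dz`:
`ψ(ρ) = ∫_{ℝ^d} (1 - cos(ρ z₁)) ν(|z|) dz`. -/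
noncomputable def psi (d : ℕ) (hd : 0 < d) (ν : ℝ → ℝ) (ρ : ℝ) : ℝ :=
  ∫ z : EuclideanSpace ℝ (Fin d), (1 - Real.cos (ρ * z ⟨0, hd⟩)) * ν ‖z‖

/-- `Ψ(r) = sup_{0 < s ≤ r} ψ(s)`. -/
noncomputable def Psi (d : ℕ) (hd : 0 < d) (ν : ℝ → ℝ) (r : ℝ) : ℝ :=
  sSup (psi d hd ν '' Set.Ioc 0 r)

/-- Generalized inverse `Ψ⁻¹(u) = inf{s > 0 : Ψ(s) ≥ u}`. -/
noncomputable def PsiInv (d : ℕ) (hd : 0 < d) (ν : ℝ → ℝ) (u : ℝ) : ℝ :=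
  sInf {s : ℝ | 0 < s ∧ u ≤ Psi d hd ν s}

/-- `f(r) = φ̂(1)/(r^{d+1} φ̂(r))` for `0 < r ≤ 1`, `f(r) = r^{-ℓ-1} e^{-b r^β}` for `r > 1`. -/
noncomputable def ffun (d : ℕ) (ν : ℝ → ℝ) (b β ℓ : ℝ) (r : ℝ) : ℝ :=
  if r ≤ 1 then phiHat d ν 1 / (r ^ (d + 1) * phiHat d ν r)
  else r ^ (-ℓ - 1) * Real.exp (-b * r ^ β)

/-- `f̃(r) = φ̂(1)/(r^d φ̂(r))` for `0 < r ≤ 1`, `f̃(r) = r^{-ℓ} e^{-b r^β}` for `r > 1`. -/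
noncomputable def ftil (d : ℕ) (ν : ℝ → ℝ) (b β ℓ : ℝ) (r : ℝ) : ℝ :=
  if r ≤ 1 then phiHat d ν 1 / (r ^ d * phiHat d ν r)
  else r ^ (-ℓ) * Real.exp (-b * r ^ β)

structure NuAssumptions (d : ℕ) (ν : ℝ → ℝ) (a b β ℓ a₃ α₃ : ℝ) : Prop where
  ν_pos : ∀ r : ℝ, 0 < r → 0 < ν r
  ν_anti : AntitoneOn ν (Set.Ioi 0)
  ν_diff : ∀ r : ℝ, 0 < r → DifferentiableAt ℝ ν r
  ν_int : MeasureTheory.Integrable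
      (fun y : EuclideanSpace ℝ (Fin d) => min 1 (‖y‖ ^ 2) * ν ‖y‖)
  ha : 0 < a
  hb : 0 < b
  β_pos : 0 < β
  β_le : β ≤ 1
  ℓ_nonneg : 0 ≤ ℓ
  hN1 : ∀ r : ℝ, 1 < r → ν r ≤ a * r ^ (-ℓ) * Real.exp (-b * r ^ β)
  a₃_pos : 0 < a₃
  α₃_pos : 0 < α₃
  α₃_le : α₃ ≤ 2
  hN2 : ∀ r R : ℝ, 0 < r → r ≤ R → a₃ * (R / r) ^ α₃ ≤ phiHat d ν R / phiHat d ν r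

/-- The truncated second moment `∫₀^r s^{d+1} ν(s) ds`. -/
noncomputable def truncMoment (d : ℕ) (ν : ℝ → ℝ) (r : ℝ) : ℝ :=
  ∫ s in Set.Ioo (0:ℝ) r, s ^ (d + 1) * ν s

lemma phiHat_eq (d : ℕ) (ν : ℝ → ℝ) (r : ℝ) :
    phiHat d ν r = r ^ 2 / truncMoment d ν (min r 1) := by
  unfold phiHat truncMoment
  split_ifs with h
  · rw [min_eq_left h]
  · rw [min_eq_right (le_of_not_ge h)]
    ring

/-- Polynomials are dominated by stretched exponentials. -/
lemma exists_pow_mul_exp_neg_rpow_le {c β : ℝ} (hc : 0 < c) (hβ : 0 < β) (m : ℕ) :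
    ∃ K : ℝ, 0 < K ∧ ∀ t : ℝ, 1 ≤ t → t ^ m * Real.exp (-c * t ^ β) ≤ K := by
  obtain ⟨n, hn⟩ := exists_nat_ge ((m : ℝ) / β)
  refine ⟨n.factorial / c ^ n, by positivity, fun t ht => ?_⟩
  have ht0 : 0 < t := by linarith
  have hx : 0 ≤ c * t ^ β := by positivity
  have h := Real.pow_div_factorial_le_exp _ hx n
  have hm : t ^ m ≤ (t ^ β) ^ n := by
    rw [← Real.rpow_natCast t m, ← Real.rpow_natCast (t ^ β) n, ← Real.rpow_mul ht0.le]
    apply Real.rpow_le_rpow_of_exponent_le ht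
    rw [div_le_iff₀ hβ] at hn
    linarith
  have hf : (0:ℝ) < n.factorial := by positivity
  rw [div_le_iff₀ hf, mul_pow] at h
  rw [neg_mul, Real.exp_neg, ← div_eq_mul_inv, div_le_div_iff₀ (Real.exp_pos _) (by positivity)]
  calc t ^ m * c ^ n ≤ (t ^ β) ^ n * c ^ n := by gcongr
    _ ≤ _ := by linarith

/-- Comparison of a profile with stretched-exponential tail at `max s t - t / 2` and at `s`. -/
lemma exists_profile_le {b β p A D : ℝ} (hb : 0 < b) (hβ : 0 < β) (hβ1 : β ≤ 1) (hp : 0 ≤ p)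
    {g : ℝ → ℝ} (hg1 : g 1 = 1)
    (hA : ∀ x y : ℝ, 0 < x → x ≤ y → y ≤ 1 → g y ≤ A * g x)
    (hD : ∀ x : ℝ, 0 < x → x ≤ 1 → g (x / 2) ≤ D * g x)
    (hgpos : ∀ x : ℝ, 0 < x → x ≤ 1 → 0 < g x)
    {F : ℝ → ℝ} (hF : ∀ x, F x = if x ≤ 1 then g x else x ^ (-p) * Real.exp (-b * x ^ β)) :
    (∀ x, 0 < x → 0 < F x) ∧
    ∃ C : ℝ, 0 < C ∧ ∀ s t : ℝ, 0 < s → 0 < t →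
      F (max s t - t / 2) ≤ C * F s * Real.exp (b * (t / 2) ^ β) := by
  have hA0 : 0 < A := by
    have := hA 1 1 one_pos le_rfl le_rfl
    rw [hg1] at this; linarith
  have hD0 : 0 < D := by
    have h1 := hD 1 one_pos le_rfl
    have h2 := hgpos (1 / 2) (by norm_num) (by norm_num)
    rw [hg1] at h1; linarith
  have h2p : (0:ℝ) < 2 ^ p := by positivity
  have hAD : 0 < A * D := by positivity
  have hADE : 0 < A * D * (2 ^ p * Real.exp (b * 2)) := by positivity
  refine ⟨fun x hx => ?_, A * D + A + 2 ^ p + A * D * (2 ^ p * Real.exp (b * 2)), by positivity,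
    fun s t hs ht => ?_⟩
  · rw [hF]
    split_ifs with h
    · exact hgpos x hx h
    · positivity
  have hmst : s ≤ max s t := le_max_left _ _
  have hmt : t ≤ max s t := le_max_right _ _
  set u := max s t - t / 2 with hu
  have hus : s / 2 ≤ u := by linarith
  have hu0 : 0 < u := by linarith
  have hE : 1 ≤ Real.exp (b * (t / 2) ^ β) := Real.one_le_exp (by positivity)
  have key : ∀ {C' : ℝ}, 0 ≤ C' → C' ≤ A * D + A + 2 ^ p + A * D * (2 ^ p * Real.exp (b * 2)) →
      0 ≤ F s → F u ≤ C' * F s →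
      F u ≤ (A * D + A + 2 ^ p + A * D * (2 ^ p * Real.exp (b * 2))) * F s *
        Real.exp (b * (t / 2) ^ β) := by
    intro C' h0 h1 h2 h3
    calc F u ≤ C' * F s := h3
      _ ≤ C' * F s * Real.exp (b * (t / 2) ^ β) := le_mul_of_one_le_right (by positivity) hE
      _ ≤ _ := by gcongr
  by_cases hs1 : s ≤ 1
  · have hFs : F s = g s := by rw [hF, if_pos hs1]
    have hgs := hgpos s hs hs1
    by_cases hu1 : u ≤ 1
    · refine key (C' := A * D) (by positivity)
        (by linarith [hADE]) (by rw [hFs]; exact hgs.le) ?_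
      rw [hFs, hF, if_pos hu1]
      calc g u ≤ A * g (s / 2) := hA _ _ (by linarith) hus hu1
        _ ≤ A * (D * g s) := by gcongr; exact hD s hs hs1
        _ = _ := by ring
    · push Not at hu1
      refine key (C' := A) (by positivity)
        (by linarith [hADE, hAD]) (by rw [hFs]; exact hgs.le) ?_
      rw [hFs, hF, if_neg (not_le.2 hu1)]
      have h1 : u ^ (-p) ≤ 1 := Real.rpow_le_one_of_one_le_of_nonpos hu1.le (by linarith)
      have h2 : Real.exp (-b * u ^ β) ≤ 1 := by
        rw [Real.exp_le_one_iff]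
        have : 0 < b * u ^ β := by positivity
        linarith
      calc u ^ (-p) * Real.exp (-b * u ^ β) ≤ 1 * 1 := by gcongr
        _ = g 1 := by rw [hg1]; ring
        _ ≤ A * g s := hA _ _ hs hs1 le_rfl
  · have hFs : F s = s ^ (-p) * Real.exp (-b * s ^ β) := by rw [hF, if_neg hs1]
    push Not at hs1
    by_cases hu1 : u ≤ 1
    · have hs2 : s ≤ 2 := by linarith
      refine key (C' := A * D * (2 ^ p * Real.exp (b * 2))) (by positivity)
        (by linarith [hAD]) (by rw [hFs]; positivity) ?_
      rw [hFs, hF, if_pos hu1]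
      have h1 : (1:ℝ) ≤ 2 ^ p * s ^ (-p) := by
        rw [Real.rpow_neg hs.le, ← div_eq_mul_inv, one_le_div (by positivity)]
        exact Real.rpow_le_rpow hs.le hs2 hp
      have h2 : 1 ≤ Real.exp (b * 2) * Real.exp (-b * s ^ β) := by
        rw [← Real.exp_add]
        apply Real.one_le_exp
        have : s ^ β ≤ 2 := by
          calc s ^ β ≤ s ^ (1:ℝ) := Real.rpow_le_rpow_of_exponent_le hs1.le hβ1
            _ ≤ 2 := by simpa using hs2
        nlinarith
      calc g u ≤ A * g (1 / 2) := hA _ _ (by norm_num) (by linarith) hu1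
        _ ≤ A * (D * g 1) := by gcongr; exact hD 1 one_pos le_rfl
        _ = A * D * (1 * 1) := by rw [hg1]; ring
        _ ≤ A * D * ((2 ^ p * s ^ (-p)) * (Real.exp (b * 2) * Real.exp (-b * s ^ β))) := by gcongr
        _ = _ := by ring
    · rw [hFs, hF, if_neg hu1]
      have h1 : u ^ (-p) ≤ 2 ^ p * s ^ (-p) := by
        calc u ^ (-p) ≤ (s / 2) ^ (-p) :=
              Real.rpow_le_rpow_of_nonpos (by positivity) hus (by linarith)
          _ = 2 ^ p * s ^ (-p) := by
              rw [Real.div_rpow hs.le (by norm_num), Real.rpow_neg (by norm_num : (0:ℝ) ≤ 2)]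
              field_simp
      have h2 : Real.exp (-b * u ^ β) ≤ Real.exp (-b * s ^ β) * Real.exp (b * (t / 2) ^ β) := by
        rw [← Real.exp_add]
        apply Real.exp_le_exp.2
        have h3 : s ^ β ≤ u ^ β + (t / 2) ^ β := by
          calc s ^ β ≤ (u + t / 2) ^ β := Real.rpow_le_rpow hs.le (by linarith) hβ.le
            _ ≤ _ := Real.rpow_add_le_add_rpow hu0.le (by linarith) hβ.le hβ1
        nlinarith
      calc u ^ (-p) * Real.exp (-b * u ^ β)
          ≤ (2 ^ p * s ^ (-p)) * (Real.exp (-b * s ^ β) * Real.exp (b * (t / 2) ^ β)) := by gcongr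
        _ = 2 ^ p * (s ^ (-p) * Real.exp (-b * s ^ β)) * Real.exp (b * (t / 2) ^ β) := by ring
        _ ≤ _ := by
          gcongr
          linarith [hADE, hAD]

/-- Polar coordinates for a radial integral over the complement of a ball. -/
lemma setIntegral_norm_gt (n : ℕ) (hn : 0 < n) (G : ℝ → ℝ) {r : ℝ} (hr : 0 < r) :
    ∫ y in {y : EuclideanSpace ℝ (Fin n) | r < ‖y‖}, G ‖y‖ =
      (n * volume.real (Metric.ball (0 : EuclideanSpace ℝ (Fin n)) 1)) *
        ∫ t in Ioi r, t ^ (n - 1) * G t := by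
  have : Nonempty (Fin n) := ⟨⟨0, hn⟩⟩
  have hm : MeasurableSet {y : EuclideanSpace ℝ (Fin n) | r < ‖y‖} :=
    measurableSet_lt measurable_const measurable_norm
  rw [← integral_indicator hm]
  have h := integral_fun_norm_addHaar (E := EuclideanSpace ℝ (Fin n)) volume ((Ioi r).indicator G)
  have e1 : (fun x : EuclideanSpace ℝ (Fin n) => (Ioi r).indicator G ‖x‖) =
      {y : EuclideanSpace ℝ (Fin n) | r < ‖y‖}.indicator (fun y => G ‖y‖) := by
    ext x; simp [indicator]
  rw [e1] at h
  rw [h]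
  simp only [finrank_euclideanSpace, Fintype.card_fin, smul_eq_mul, nsmul_eq_mul]
  rw [mul_assoc]
  congr 2
  have e2 : (fun y : ℝ => y ^ (n - 1) * (Ioi r).indicator G y) =
      (Ioi r).indicator (fun y => y ^ (n - 1) * G y) := by
    ext x; simp [indicator]
  rw [e2, setIntegral_indicator measurableSet_Ioi, Ioi_inter_Ioi, max_eq_right hr.le]

/-- Polar coordinates for the second moment of a radial density on a ball. -/
lemma setIntegral_ball_norm_sq (n : ℕ) (hn : 0 < n) (G : ℝ → ℝ) (r : ℝ) :
    ∫ y in Metric.ball (0 : EuclideanSpace ℝ (Fin n)) r, ‖y‖ ^ 2 * G ‖y‖ =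
      (n * volume.real (Metric.ball (0 : EuclideanSpace ℝ (Fin n)) 1)) * truncMoment n G r := by
  have : Nonempty (Fin n) := ⟨⟨0, hn⟩⟩
  rw [← integral_indicator Metric.isOpen_ball.measurableSet]
  have h := integral_fun_norm_addHaar (E := EuclideanSpace ℝ (Fin n)) volume
    ((Iio r).indicator (fun t => t ^ 2 * G t))
  have e1 : (fun x : EuclideanSpace ℝ (Fin n) => (Iio r).indicator (fun t => t ^ 2 * G t) ‖x‖) =
      (Metric.ball (0 : EuclideanSpace ℝ (Fin n)) r).indicator (fun y => ‖y‖ ^ 2 * G ‖y‖) := by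
    ext x; simp [indicator]
  rw [e1] at h
  rw [h]
  simp only [finrank_euclideanSpace, Fintype.card_fin, smul_eq_mul, nsmul_eq_mul]
  rw [mul_assoc]
  congr 2
  have e2 : (fun y : ℝ => y ^ (n - 1) * (Iio r).indicator (fun t => t ^ 2 * G t) y) =
      (Iio r).indicator (fun y => y ^ (n + 1) * G y) := by
    ext x
    obtain ⟨k, rfl⟩ : ∃ k, n = k + 1 := ⟨n - 1, by omega⟩
    by_cases hx : x < r <;> simp [indicator, hx]
    ring
  rw [e2, setIntegral_indicator measurableSet_Iio, Ioi_inter_Iio, truncMoment]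

/-- All coordinates have the same second moment under a radial density on a ball. -/
lemma setIntegral_ball_coord_sq (n : ℕ) (i j : Fin n) (G : ℝ → ℝ) (r : ℝ) :
    ∫ y in Metric.ball (0 : EuclideanSpace ℝ (Fin n)) r, y i ^ 2 * G ‖y‖ =
      ∫ y in Metric.ball (0 : EuclideanSpace ℝ (Fin n)) r, y j ^ 2 * G ‖y‖ := by
  let e := LinearIsometryEquiv.piLpCongrLeft 2 ℝ ℝ (Equiv.swap i j)
  have hmp : MeasurePreserving (e : EuclideanSpace ℝ (Fin n) → EuclideanSpace ℝ (Fin n)) :=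
    e.measurePreserving
  have h := hmp.setIntegral_preimage_emb e.toHomeomorph.measurableEmbedding
    (fun y => y i ^ 2 * G ‖y‖) (Metric.ball (0 : EuclideanSpace ℝ (Fin n)) r)
  rw [← h]
  have hpre : e ⁻¹' Metric.ball (0 : EuclideanSpace ℝ (Fin n)) r = Metric.ball 0 r := by
    ext x; simp
  rw [hpre]
  refine setIntegral_congr_fun Metric.isOpen_ball.measurableSet fun y _ => ?_
  simp [e, LinearIsometryEquiv.piLpCongrLeft_apply, Equiv.piCongrLeft'_apply]

namespace NuAssumptions

variable {d : ℕ} {ν : ℝ → ℝ} {a b β ℓ a₃ α₃ : ℝ}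

lemma integrableOn_truncMoment (H : NuAssumptions d ν a b β ℓ a₃ α₃) (hd : 0 < d) :
    IntegrableOn (fun s : ℝ => s ^ (d + 1) * ν s) (Ioo 0 1) := by
  have : Nonempty (Fin d) := ⟨⟨0, hd⟩⟩
  have h := (integrable_fun_norm_addHaar (E := EuclideanSpace ℝ (Fin d)) volume
    (f := fun t => min 1 (t ^ 2) * ν t)).1 H.ν_int
  refine (h.mono_set Ioo_subset_Ioi_self).congr_fun (fun x hx => ?_) measurableSet_Ioo
  obtain ⟨k, rfl⟩ : ∃ k, d = k + 1 := ⟨d - 1, by omega⟩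
  have hx2 : x ^ 2 ≤ 1 := pow_le_one₀ hx.1.le hx.2.le
  simp only [finrank_euclideanSpace, Fintype.card_fin, smul_eq_mul, min_eq_right hx2,
    Nat.add_sub_cancel]
  ring

lemma truncMoment_mono (H : NuAssumptions d ν a b β ℓ a₃ α₃) (hd : 0 < d) {r R : ℝ}
    (hrR : r ≤ R) (hR : R ≤ 1) : truncMoment d ν r ≤ truncMoment d ν R := by
  refine setIntegral_mono_set ((H.integrableOn_truncMoment hd).mono_set
    (Ioo_subset_Ioo_right hR)) ?_ (Ioo_subset_Ioo_right hrR).eventuallyLE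
  filter_upwards [ae_restrict_mem measurableSet_Ioo] with s hs
  exact mul_nonneg (pow_nonneg hs.1.le _) (H.ν_pos s hs.1).le

lemma mul_pow_le_truncMoment (H : NuAssumptions d ν a b β ℓ a₃ α₃) (hd : 0 < d) {r : ℝ}
    (hr : 0 < r) (hr1 : r ≤ 1) : ν r * r ^ (d + 2) ≤ (d + 2) * truncMoment d ν r := by
  have h1 : ∫ s in Ioo (0:ℝ) r, s ^ (d + 1) * ν r ≤ truncMoment d ν r := by
    refine integral_mono_of_nonneg ?_ ((H.integrableOn_truncMoment hd).mono_set
      (Ioo_subset_Ioo_right hr1)) ?_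
    · filter_upwards [ae_restrict_mem measurableSet_Ioo] with s hs
      exact mul_nonneg (pow_nonneg hs.1.le _) (H.ν_pos r hr).le
    · filter_upwards [ae_restrict_mem measurableSet_Ioo] with s hs
      exact mul_le_mul_of_nonneg_left (H.ν_anti hs.1 hr hs.2.le) (pow_nonneg hs.1.le _)
  rw [← integral_Ioc_eq_integral_Ioo, ← intervalIntegral.integral_of_le hr.le,
    intervalIntegral.integral_mul_const, integral_pow] at h1
  have h2 : (0:ℝ) < d + 2 := by positivity
  push_cast at h1
  rw [zero_pow (by omega), sub_zero, show (d:ℝ) + 1 + 1 = d + 2 by ring, div_mul_eq_mul_div,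
    div_le_iff₀ h2] at h1
  calc ν r * r ^ (d + 2) = r ^ (d + 1 + 1) * ν r := by ring
    _ ≤ _ := by linarith

lemma truncMoment_pos (H : NuAssumptions d ν a b β ℓ a₃ α₃) (hd : 0 < d) {r : ℝ}
    (hr : 0 < r) (hr1 : r ≤ 1) : 0 < truncMoment d ν r := by
  have h1 := H.mul_pow_le_truncMoment hd hr hr1
  have h2 : 0 < ν r * r ^ (d + 2) := mul_pos (H.ν_pos r hr) (by positivity)
  have h3 : (0:ℝ) < d + 2 := by positivity
  exact pos_of_mul_pos_right (h2.trans_le h1) h3.le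

lemma phiHat_pos (H : NuAssumptions d ν a b β ℓ a₃ α₃) (hd : 0 < d) {r : ℝ} (hr : 0 < r) :
    0 < phiHat d ν r := by
  rw [phiHat_eq]
  exact div_pos (by positivity) (H.truncMoment_pos hd (lt_min hr one_pos) (min_le_right _ _))

/-- The profile `φ̂(1) / (r^n φ̂(r))` continued by a stretched exponential. -/
lemma exists_phiHat_profile_le (H : NuAssumptions d ν a b β ℓ a₃ α₃) (hd : 0 < d) (n : ℕ)
    {p : ℝ} (hp : 0 ≤ p) {F : ℝ → ℝ}
    (hF : ∀ x, F x = if x ≤ 1 then phiHat d ν 1 / (x ^ n * phiHat d ν x)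
      else x ^ (-p) * Real.exp (-b * x ^ β)) :
    (∀ x, 0 < x → 0 < F x) ∧
    ∃ C : ℝ, 0 < C ∧ ∀ s t : ℝ, 0 < s → 0 < t →
      F (max s t - t / 2) ≤ C * F s * Real.exp (b * (t / 2) ^ β) := by
  have h1 := H.phiHat_pos hd one_pos
  have ha₃ := H.a₃_pos
  refine exists_profile_le (A := a₃⁻¹) (D := 2 ^ (n + 2)) H.hb H.β_pos H.β_le hp ?_ ?_ ?_ ?_ hF
  · rw [one_pow, one_mul, div_self h1.ne']
  · intro x y hx hxy _
    have hy : 0 < y := hx.trans_le hxy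
    have hφx := H.phiHat_pos hd hx
    have hφy := H.phiHat_pos hd hy
    have h2 : a₃ * phiHat d ν x ≤ phiHat d ν y := by
      rw [← le_div_iff₀ hφx]
      refine le_trans ?_ (H.hN2 x y hx hxy)
      refine le_mul_of_one_le_right ha₃.le ?_
      exact Real.one_le_rpow ((one_le_div hx).2 hxy) H.α₃_pos.le
    calc phiHat d ν 1 / (y ^ n * phiHat d ν y)
        ≤ phiHat d ν 1 / (x ^ n * (a₃ * phiHat d ν x)) := by gcongr
      _ = _ := by field_simp
  · intro x hx hx1
    have hm := H.truncMoment_mono hd (show x / 2 ≤ x by linarith) hx1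
    have hp1 := H.truncMoment_pos hd hx hx1
    have hp2 := H.truncMoment_pos hd (half_pos hx) (by linarith)
    rw [phiHat_eq d ν x, phiHat_eq d ν (x / 2), min_eq_left hx1, min_eq_left (by linarith)]
    have e1 : phiHat d ν 1 / ((x / 2) ^ n * ((x / 2) ^ 2 / truncMoment d ν (x / 2))) =
        2 ^ (n + 2) * (phiHat d ν 1 / x ^ (n + 2)) * truncMoment d ν (x / 2) := by
      rw [div_pow, div_pow]; field_simp; ring
    have e2 : 2 ^ (n + 2) * (phiHat d ν 1 / (x ^ n * (x ^ 2 / truncMoment d ν x))) =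
        2 ^ (n + 2) * (phiHat d ν 1 / x ^ (n + 2)) * truncMoment d ν x := by
      field_simp; ring
    rw [e1, e2]
    gcongr
  · intro x hx _
    have := H.phiHat_pos hd hx
    positivity

/-- The exponentially weighted density is controlled by `1 / φ̂`. -/
lemma exists_weight_mul_le (H : NuAssumptions d ν a b β ℓ a₃ α₃) (hd : 0 < d) :
    ∃ C : ℝ, 0 < C ∧ ∀ t : ℝ, 0 < t →
      t ^ d * (1 + t ^ β) * Real.exp (b * (t / 2) ^ β) * ν t ≤ C / phiHat d ν t := by
  have hb := H.hb
  have hβ := H.β_pos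
  have ha := H.ha
  have hL1 := H.truncMoment_pos hd one_pos le_rfl
  have h2β : (2⁻¹ : ℝ) ^ β < 1 := Real.rpow_lt_one (by norm_num) (by norm_num) hβ
  obtain ⟨K, hK0, hK⟩ := exists_pow_mul_exp_neg_rpow_le
    (show 0 < b * (1 - (2⁻¹ : ℝ) ^ β) from mul_pos hb (by linarith)) hβ (d + 3)
  refine ⟨2 * Real.exp b * (d + 2) + 2 * a * K / truncMoment d ν 1, by positivity,
    fun t ht => ?_⟩
  have hν := H.ν_pos t ht
  rw [phiHat_eq, div_div_eq_mul_div, le_div_iff₀ (by positivity)]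
  by_cases ht1 : t ≤ 1
  · rw [min_eq_left ht1]
    have hL := H.truncMoment_pos hd ht ht1
    have h1 : t ^ β ≤ 1 := Real.rpow_le_one ht.le ht1 hβ.le
    have h2 : (t / 2) ^ β ≤ 1 := Real.rpow_le_one (by positivity) (by linarith) hβ.le
    calc t ^ d * (1 + t ^ β) * Real.exp (b * (t / 2) ^ β) * ν t * t ^ 2
        ≤ t ^ d * (1 + 1) * Real.exp (b * 1) * ν t * t ^ 2 := by gcongr
      _ = 2 * Real.exp b * (ν t * t ^ (d + 2)) := by rw [mul_one]; ring
      _ ≤ 2 * Real.exp b * ((d + 2) * truncMoment d ν t) :=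
          mul_le_mul_of_nonneg_left (H.mul_pow_le_truncMoment hd ht ht1) (by positivity)
      _ = (2 * Real.exp b * (d + 2) + 0) * truncMoment d ν t := by ring
      _ ≤ _ := by gcongr; positivity
  · push Not at ht1
    rw [min_eq_right ht1.le]
    have h1 : 1 + t ^ β ≤ 2 * t := by
      have : t ^ β ≤ t ^ (1:ℝ) := Real.rpow_le_rpow_of_exponent_le ht1.le H.β_le
      rw [Real.rpow_one] at this
      linarith
    have h2 : ν t ≤ a * Real.exp (-b * t ^ β) := by
      refine (H.hN1 t ht1).trans ?_
      have : t ^ (-ℓ) ≤ 1 :=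
        Real.rpow_le_one_of_one_le_of_nonpos ht1.le (by linarith [H.ℓ_nonneg])
      calc a * t ^ (-ℓ) * Real.exp (-b * t ^ β) ≤ a * 1 * Real.exp (-b * t ^ β) := by gcongr
        _ = _ := by ring
    have h3 : Real.exp (b * (t / 2) ^ β) * Real.exp (-b * t ^ β) =
        Real.exp (-(b * (1 - (2⁻¹ : ℝ) ^ β)) * t ^ β) := by
      rw [← Real.exp_add, div_eq_mul_inv, Real.mul_rpow ht.le (by norm_num)]
      ring_nf
    calc t ^ d * (1 + t ^ β) * Real.exp (b * (t / 2) ^ β) * ν t * t ^ 2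
        ≤ t ^ d * (2 * t) * Real.exp (b * (t / 2) ^ β) * (a * Real.exp (-b * t ^ β)) * t ^ 2 := by
          gcongr
      _ = 2 * a * (t ^ (d + 3) * (Real.exp (b * (t / 2) ^ β) * Real.exp (-b * t ^ β))) := by ring
      _ ≤ 2 * a * K := by
          rw [h3]; gcongr; exact hK t ht1.le
      _ = (0 + 2 * a * K / truncMoment d ν 1) * truncMoment d ν 1 := by field_simp; ring
      _ ≤ _ := by gcongr; positivity

/-- The weighted density decays at least like a power on `[r, ∞)`. -/
lemma exists_weight_mul_le_rpow (H : NuAssumptions d ν a b β ℓ a₃ α₃) (hd : 0 < d) :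
    ∃ C : ℝ, 0 < C ∧ ∀ r t : ℝ, 0 < r → r ≤ t →
      t ^ d * (1 + t ^ β) * Real.exp (b * (t / 2) ^ β) * ν t ≤
        C / phiHat d ν r * r ^ α₃ * t ^ (-α₃) := by
  obtain ⟨C, hC, h⟩ := H.exists_weight_mul_le hd
  have ha₃ := H.a₃_pos
  refine ⟨C / a₃, by positivity, fun r t hr hrt => (h t (hr.trans_le hrt)).trans ?_⟩
  have ht : 0 < t := hr.trans_le hrt
  have hφr := H.phiHat_pos hd hr
  have hφt := H.phiHat_pos hd ht
  have h1 := H.hN2 r t hr hrt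
  rw [le_div_iff₀ hφr, Real.div_rpow ht.le hr.le] at h1
  rw [Real.rpow_neg ht.le]
  have hrα : 0 < r ^ α₃ := by positivity
  have htα : 0 < t ^ α₃ := by positivity
  calc C / phiHat d ν t ≤ C / (a₃ * (t ^ α₃ / r ^ α₃) * phiHat d ν r) := by gcongr
    _ = _ := by field_simp

lemma deriv_nonpos (H : NuAssumptions d ν a b β ℓ a₃ α₃) {t : ℝ} (ht : 0 < t) :
    deriv ν t ≤ 0 := by
  rw [← derivWithin_of_mem_nhds (Ioi_mem_nhds ht)]
  exact H.ν_anti.derivWithin_nonpos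

end NuAssumptions

/-- Integration by parts in the form of a one-sided estimate with integrable majorant. -/
lemma exists_majorant_neg_deriv {ν W W' : ℝ → ℝ} {r α K M : ℝ} (hr : 0 < r) (hα : 0 < α)
    (hν : ∀ t, r ≤ t → DifferentiableAt ℝ ν t) (hW : ∀ t, r ≤ t → HasDerivAt W (W' t) t)
    (hνd : ∀ t, r ≤ t → deriv ν t ≤ 0) (hW0 : ∀ t, r ≤ t → 0 ≤ W t) (hν0 : ∀ t, r ≤ t → 0 ≤ ν t)
    (hWν : ∀ t, r ≤ t → W t * ν t ≤ K * t ^ (-α))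
    (hWν' : ∀ t, r ≤ t → W' t * ν t ≤ M * t ^ (-α - 1)) :
    ∃ g : ℝ → ℝ, IntegrableOn g (Ioi r) ∧ (∀ t, r ≤ t → W t * -deriv ν t ≤ g t) ∧
      ∫ t in Ioi r, g t ≤ (K + M / α) * r ^ (-α) := by
  let G : ℝ → ℝ := fun t => -(W t * ν t) - M / α * t ^ (-α)
  let g : ℝ → ℝ := fun t => -(W' t * ν t + W t * deriv ν t) - M / α * (-α * t ^ (-α - 1))
  have hg : ∀ t, r ≤ t → W t * -deriv ν t ≤ g t := by
    intro t ht
    have h1 := hWν' t ht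
    have h2 : g t = W t * -deriv ν t + (M * t ^ (-α - 1) - W' t * ν t) := by
      simp only [g]; field_simp; ring
    linarith
  have hG : ∀ t ∈ Ici r, HasDerivAt G (g t) t := by
    intro t ht
    have ht0 : 0 < t := hr.trans_le ht
    exact (((hW t ht).mul (hν t ht).hasDerivAt).neg).sub
      ((Real.hasDerivAt_rpow_const (Or.inl ht0.ne')).const_mul _)
  have hg0 : ∀ t ∈ Ioi r, 0 ≤ g t := fun t ht =>
    (mul_nonneg (hW0 t (le_of_lt ht)) (neg_nonneg.2 (hνd t (le_of_lt ht)))).trans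
      (hg t (le_of_lt ht))
  have hp : Tendsto (fun t : ℝ => t ^ (-α)) atTop (nhds 0) := tendsto_rpow_neg_atTop hα
  have hlim : Tendsto G atTop (nhds 0) := by
    have h1 : Tendsto (fun t => W t * ν t) atTop (nhds 0) := by
      refine squeeze_zero' ?_ ?_ (by simpa using hp.const_mul K)
      · filter_upwards [eventually_ge_atTop r] with t ht
        exact mul_nonneg (hW0 t ht) (hν0 t ht)
      · filter_upwards [eventually_ge_atTop r] with t ht
        exact hWν t ht
    simpa [G] using h1.neg.sub (hp.const_mul (M / α))
  refine ⟨g, integrableOn_Ioi_deriv_of_nonneg' hG hg0 hlim, hg, ?_⟩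
  rw [integral_Ioi_of_hasDerivAt_of_nonneg' hG hg0 hlim]
  have := hWν r le_rfl
  simp only [G]
  linarith

namespace NuAssumptions

variable {d : ℕ} {ν : ℝ → ℝ} {a b β ℓ a₃ α₃ : ℝ}

lemma integrableOn_mul_nu_norm (H : NuAssumptions d ν a b β ℓ a₃ α₃)
    {S : Set (EuclideanSpace ℝ (Fin d))} (hS : MeasurableSet S)
    {q : EuclideanSpace ℝ (Fin d) → ℝ} (hq : Measurable q) {C : ℝ}
    (hqC : ∀ z ∈ S, |q z| ≤ C * min 1 (‖z‖ ^ 2)) :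
    IntegrableOn (fun z => q z * ν ‖z‖) S := by
  have hmeas : Measurable fun z : EuclideanSpace ℝ (Fin d) => q z / min 1 (‖z‖ ^ 2) := by
    fun_prop
  have h := (H.ν_int.integrableOn (s := S)).bdd_mul (c := |C|) hmeas.aestronglyMeasurable (by
    filter_upwards [ae_restrict_mem hS] with z hz
    have h0 : 0 ≤ min 1 (‖z‖ ^ 2) := by positivity
    rw [Real.norm_eq_abs, abs_div, abs_of_nonneg h0]
    exact div_le_of_le_mul₀ h0 (abs_nonneg _) ((hqC z hz).trans (by gcongr; exact le_abs_self C)))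
  refine h.congr ?_
  filter_upwards [ae_restrict_mem hS] with z hz
  rcases eq_or_ne z 0 with rfl | hz0
  · have := hqC 0 hz
    simp at this
    simp [this]
  · have : 0 < min 1 (‖z‖ ^ 2) := by positivity
    field_simp

lemma abs_one_sub_cos_mul_coord_le (i : Fin d) (ρ : ℝ) (z : EuclideanSpace ℝ (Fin d)) :
    |1 - Real.cos (ρ * z i)| ≤ (2 + ρ ^ 2) * min 1 (‖z‖ ^ 2) := by
  have h1 := Real.cos_le_one (ρ * z i)
  have h2 := Real.neg_one_le_cos (ρ * z i)
  have h3 := Real.one_sub_sq_div_two_le_cos (x := ρ * z i)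
  have h4 : z i ^ 2 ≤ ‖z‖ ^ 2 := by
    have := PiLp.norm_apply_le z i
    rw [Real.norm_eq_abs] at this
    exact sq_le_sq.2 (by rwa [abs_of_nonneg (norm_nonneg z)])
  have h5 := mul_le_mul_of_nonneg_left h4 (sq_nonneg ρ)
  rw [abs_of_nonneg (by linarith)]
  rcases le_total 1 (‖z‖ ^ 2) with h | h
  · rw [min_eq_left h]
    nlinarith [sq_nonneg ρ]
  · rw [min_eq_right h]
    nlinarith [sq_nonneg ρ, sq_nonneg ‖z‖]

lemma integrable_psi (H : NuAssumptions d ν a b β ℓ a₃ α₃) (i : Fin d) (ρ : ℝ) :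
    Integrable fun z : EuclideanSpace ℝ (Fin d) => (1 - Real.cos (ρ * z i)) * ν ‖z‖ := by
  rw [← integrableOn_univ]
  exact H.integrableOn_mul_nu_norm MeasurableSet.univ (by fun_prop)
    fun z _ => abs_one_sub_cos_mul_coord_le i ρ z

lemma ae_nu_norm_nonneg (H : NuAssumptions d ν a b β ℓ a₃ α₃) (hd : 0 < d) :
    ∀ᵐ z : EuclideanSpace ℝ (Fin d), 0 ≤ ν ‖z‖ := by
  have : Nonempty (Fin d) := ⟨⟨0, hd⟩⟩
  filter_upwards [Measure.ae_ne volume (0 : EuclideanSpace ℝ (Fin d))] with z hz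
  exact (H.ν_pos _ (norm_pos_iff.2 hz)).le

lemma psi_le_Psi (H : NuAssumptions d ν a b β ℓ a₃ α₃) (hd : 0 < d) {ρ : ℝ} (hρ : 0 < ρ) :
    psi d hd ν ρ ≤ Psi d hd ν ρ := by
  refine le_csSup ⟨(2 + ρ ^ 2) * ∫ z : EuclideanSpace ℝ (Fin d), min 1 (‖z‖ ^ 2) * ν ‖z‖, ?_⟩
    ⟨ρ, ⟨hρ, le_rfl⟩, rfl⟩
  rintro _ ⟨σ, ⟨hσ, hσρ⟩, rfl⟩
  rw [psi, ← integral_const_mul]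
  refine integral_mono_ae (H.integrable_psi _ _) (H.ν_int.const_mul _) ?_
  filter_upwards [H.ae_nu_norm_nonneg hd] with z hz
  rw [← mul_assoc]
  refine mul_le_mul_of_nonneg_right ?_ hz
  calc _ ≤ |1 - Real.cos (σ * z ⟨0, hd⟩)| := le_abs_self _
    _ ≤ (2 + σ ^ 2) * min 1 (‖z‖ ^ 2) := abs_one_sub_cos_mul_coord_le _ _ _
    _ ≤ _ := by gcongr

lemma setIntegral_ball_coord_sq_eq (H : NuAssumptions d ν a b β ℓ a₃ α₃) (i : Fin d) {m : ℝ}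
    (hm : m ≤ 1) :
    ∫ z in Metric.ball (0 : EuclideanSpace ℝ (Fin d)) m, z i ^ 2 * ν ‖z‖ =
      volume.real (Metric.ball (0 : EuclideanSpace ℝ (Fin d)) 1) * truncMoment d ν m := by
  have hd : 0 < d := i.pos
  have hintegr : ∀ j : Fin d, IntegrableOn
      (fun z : EuclideanSpace ℝ (Fin d) => z j ^ 2 * ν ‖z‖) (Metric.ball 0 m) := by
    intro j
    refine H.integrableOn_mul_nu_norm (C := 1) Metric.isOpen_ball.measurableSet (by fun_prop)
      fun z hz => ?_
    have h1 : ‖z‖ ≤ 1 := (mem_ball_zero_iff.1 hz).le.trans hm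
    have := PiLp.norm_apply_le z j
    rw [min_eq_right (pow_le_one₀ (norm_nonneg z) h1), one_mul, abs_pow]
    gcongr
    simpa using this
  have h1 := setIntegral_ball_norm_sq d hd ν m
  have h2 : ∫ z in Metric.ball (0 : EuclideanSpace ℝ (Fin d)) m, ‖z‖ ^ 2 * ν ‖z‖ =
      d * ∫ z in Metric.ball (0 : EuclideanSpace ℝ (Fin d)) m, z i ^ 2 * ν ‖z‖ := by
    simp_rw [EuclideanSpace.real_norm_sq_eq, Finset.sum_mul]
    rw [integral_finsetSum _ fun j _ => hintegr j]
    simp_rw [fun j => setIntegral_ball_coord_sq d j i ν m]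
    simp
  rw [h2, mul_assoc] at h1
  exact mul_left_cancel₀ (by positivity) h1

/-- The lower bound `Ψ(1/r) ≥ c / φ̂(r)`. -/
lemma exists_div_phiHat_le_Psi (H : NuAssumptions d ν a b β ℓ a₃ α₃) (hd : 0 < d) :
    ∃ c : ℝ, 0 < c ∧ ∀ r : ℝ, 0 < r → c / phiHat d ν r ≤ Psi d hd ν (1 / r) := by
  have hvol : 0 < volume.real (Metric.ball (0 : EuclideanSpace ℝ (Fin d)) 1) :=
    ENNReal.toReal_pos (Metric.measure_ball_pos _ _ one_pos).ne' measure_ball_lt_top.ne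
  refine ⟨2 / Real.pi ^ 2 * volume.real (Metric.ball (0 : EuclideanSpace ℝ (Fin d)) 1),
    by positivity, fun r hr => le_trans ?_ (H.psi_le_Psi hd (by positivity))⟩
  set i : Fin d := ⟨0, hd⟩ with hi
  have hintegr := H.integrable_psi i (1 / r)
  have hnn : ∀ᵐ z : EuclideanSpace ℝ (Fin d), 0 ≤ (1 - Real.cos (1 / r * z i)) * ν ‖z‖ := by
    filter_upwards [H.ae_nu_norm_nonneg hd] with z hz
    exact mul_nonneg (by linarith [Real.cos_le_one (1 / r * z i)]) hz
  calc 2 / Real.pi ^ 2 * volume.real (Metric.ball (0 : EuclideanSpace ℝ (Fin d)) 1) /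
        phiHat d ν r
      = 2 / Real.pi ^ 2 / r ^ 2 *
        ∫ z in Metric.ball (0 : EuclideanSpace ℝ (Fin d)) (min r 1), z i ^ 2 * ν ‖z‖ := by
        rw [H.setIntegral_ball_coord_sq_eq i (min_le_right _ _), phiHat_eq]
        field_simp
    _ = ∫ z in Metric.ball (0 : EuclideanSpace ℝ (Fin d)) (min r 1),
          2 / Real.pi ^ 2 / r ^ 2 * (z i ^ 2 * ν ‖z‖) := by rw [integral_const_mul]
    _ ≤ ∫ z in Metric.ball (0 : EuclideanSpace ℝ (Fin d)) (min r 1),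
          (1 - Real.cos (1 / r * z i)) * ν ‖z‖ := by
        refine integral_mono_of_nonneg ?_ hintegr.integrableOn ?_
        · filter_upwards [ae_restrict_of_ae (H.ae_nu_norm_nonneg hd)] with z hz
          exact mul_nonneg (by positivity) (mul_nonneg (sq_nonneg _) hz)
        · filter_upwards [ae_restrict_of_ae (H.ae_nu_norm_nonneg hd),
            ae_restrict_mem Metric.isOpen_ball.measurableSet] with z hz hzb
          rw [← mul_assoc]
          refine mul_le_mul_of_nonneg_right ?_ hz
          have h1 : ‖z‖ ≤ r := (mem_ball_zero_iff.1 hzb).le.trans (min_le_left _ _)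
          have h2 : |z i| ≤ r := (PiLp.norm_apply_le z i).trans h1
          have h3 : |1 / r * z i| ≤ Real.pi := by
            rw [abs_mul, abs_of_pos (by positivity : 0 < 1 / r), one_div_mul_eq_div,
              div_le_iff₀ hr]
            nlinarith [Real.pi_gt_three]
          have h4 := Real.cos_le_one_sub_mul_cos_sq h3
          have h5 : 2 / Real.pi ^ 2 / r ^ 2 * z i ^ 2 = 2 / Real.pi ^ 2 * (1 / r * z i) ^ 2 := by
            field_simp
          linarith
    _ ≤ psi d hd ν (1 / r) := setIntegral_le_integral hintegr hnn

/-- Majorant for the radial profile integral against `ν`. -/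
lemma exists_setIntegral_weight_nu_le (H : NuAssumptions d ν a b β ℓ a₃ α₃) (hd : 0 < d) :
    ∃ C : ℝ, 0 < C ∧ ∀ r : ℝ, 0 < r → ∃ g : ℝ → ℝ, IntegrableOn g (Ioi r) ∧
      (∀ t, r ≤ t → t ^ (d - 1) * (Real.exp (b * (t / 2) ^ β) * ν t) ≤ g t) ∧
      ∫ t in Ioi r, g t ≤ C / phiHat d ν r := by
  obtain ⟨C, hC, h⟩ := H.exists_weight_mul_le_rpow hd
  have hα := H.α₃_pos
  refine ⟨C / α₃, by positivity, fun r hr => ⟨fun t => C / phiHat d ν r * r ^ α₃ * t ^ (-α₃ - 1),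
    (integrableOn_Ioi_rpow_of_lt (by linarith) hr).const_mul _, fun t ht => ?_, ?_⟩⟩
  · have ht0 : 0 < t := hr.trans_le ht
    have hν := H.ν_pos t ht0
    obtain ⟨k, rfl⟩ : ∃ k, d = k + 1 := ⟨d - 1, by omega⟩
    beta_reduce
    rw [Real.rpow_sub_one ht0.ne', ← mul_div_assoc, le_div_iff₀ ht0]
    refine le_trans ?_ (h r t hr ht)
    have : 0 < t ^ β := by positivity
    calc t ^ (k + 1 - 1) * (Real.exp (b * (t / 2) ^ β) * ν t) * t
        = t ^ (k + 1) * 1 * Real.exp (b * (t / 2) ^ β) * ν t := by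
          rw [Nat.add_sub_cancel]; ring
      _ ≤ _ := by gcongr; linarith
  · rw [integral_const_mul, integral_Ioi_rpow_of_lt (by linarith) hr,
      show -α₃ - 1 + 1 = -α₃ by ring, Real.rpow_neg hr.le]
    have := H.phiHat_pos hd hr
    have : 0 < r ^ α₃ := by positivity
    apply le_of_eq
    field_simp

/-- Majorant for the radial profile integral against minus the derivative of `ν`. -/
lemma exists_setIntegral_weight_neg_deriv_le (H : NuAssumptions d ν a b β ℓ a₃ α₃) (hd : 0 < d) :
    ∃ C : ℝ, 0 < C ∧ ∀ r : ℝ, 0 < r → ∃ g : ℝ → ℝ, IntegrableOn g (Ioi r) ∧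
      (∀ t, r ≤ t → t ^ d * Real.exp (b * (t / 2) ^ β) * -deriv ν t ≤ g t) ∧
      ∫ t in Ioi r, g t ≤ C / phiHat d ν r := by
  obtain ⟨C, hC, h⟩ := H.exists_weight_mul_le_rpow hd
  have hα := H.α₃_pos
  have hb := H.hb
  have hβ := H.β_pos
  refine ⟨C * (1 + (d + b) / α₃), by positivity, fun r hr => ?_⟩
  have hφ := H.phiHat_pos hd hr
  set K := C / phiHat d ν r * r ^ α₃ with hK
  have hmaj : ∃ g : ℝ → ℝ, IntegrableOn g (Ioi r) ∧
      (∀ t, r ≤ t → t ^ d * Real.exp (b * (t / 2) ^ β) * -deriv ν t ≤ g t) ∧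
      ∫ t in Ioi r, g t ≤ (K + (d + b) * K / α₃) * r ^ (-α₃) := by
    refine exists_majorant_neg_deriv (W := fun t => t ^ d * Real.exp (b * (t / 2) ^ β))
      (W' := fun t => (d * t ^ (d - 1)) * Real.exp (b * (t / 2) ^ β) +
        t ^ d * (Real.exp (b * (t / 2) ^ β) * (b * (1 / 2 * β * (t / 2) ^ (β - 1))))) hr hα
      (fun t ht => H.ν_diff t (hr.trans_le ht)) ?_ (fun t ht => H.deriv_nonpos (hr.trans_le ht))
      ?_ (fun t ht => (H.ν_pos t (hr.trans_le ht)).le) ?_ ?_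
    · intro t ht
      have ht0 : 0 < t := hr.trans_le ht
      have h1 : HasDerivAt (fun t : ℝ => (t / 2) ^ β) (1 / 2 * β * (t / 2) ^ (β - 1)) t :=
        ((hasDerivAt_id t).div_const 2).rpow_const (Or.inl (by simp; positivity))
      exact (hasDerivAt_pow d t).mul ((h1.const_mul b).exp)
    · intro t ht
      have ht0 : 0 < t := hr.trans_le ht
      positivity
    · intro t ht
      have ht0 : 0 < t := hr.trans_le ht
      have hν := H.ν_pos t ht0
      refine le_trans ?_ (h r t hr ht)
      have : 0 < t ^ β := by positivity
      calc t ^ d * Real.exp (b * (t / 2) ^ β) * ν t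
          = t ^ d * 1 * Real.exp (b * (t / 2) ^ β) * ν t := by ring
        _ ≤ _ := by gcongr; linarith
    · intro t ht
      have ht0 : 0 < t := hr.trans_le ht
      have hν := H.ν_pos t ht0
      have h1 := h r t hr ht
      rw [Real.rpow_sub_one ht0.ne', ← mul_div_assoc, le_div_iff₀ ht0, mul_assoc ((d:ℝ) + b)]
      refine le_trans ?_ (mul_le_mul_of_nonneg_left h1 (by positivity))
      have hβt : (t / 2) ^ β ≤ t ^ β := Real.rpow_le_rpow (by positivity) (by linarith) hβ.le
      have e1 : (t / 2) ^ (β - 1) = (t / 2) ^ β / (t / 2) := Real.rpow_sub_one (by positivity) _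
      have e2 : (d:ℝ) * t ^ (d - 1) * t = d * t ^ d := by
        obtain ⟨k, rfl⟩ : ∃ k, d = k + 1 := ⟨d - 1, by omega⟩
        rw [Nat.add_sub_cancel]; ring
      have e3 : (t / 2) ^ β * β ≤ 1 + t ^ β := by
        have := H.β_le
        have : 0 < (t / 2) ^ β := by positivity
        nlinarith
      have e4 : (1:ℝ) ≤ 1 + t ^ β := by
        have : 0 < t ^ β := by positivity
        linarith
      calc ((d * t ^ (d - 1)) * Real.exp (b * (t / 2) ^ β) +
            t ^ d * (Real.exp (b * (t / 2) ^ β) * (b * (1 / 2 * β * (t / 2) ^ (β - 1))))) * ν t * t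
          = ((d:ℝ) * t ^ (d - 1) * t * Real.exp (b * (t / 2) ^ β) +
            t ^ d * Real.exp (b * (t / 2) ^ β) * (b * ((t / 2) ^ β * β))) * ν t := by
            rw [e1]; field_simp
        _ = t ^ d * Real.exp (b * (t / 2) ^ β) * ν t * (d * 1 + b * ((t / 2) ^ β * β)) := by
            rw [e2]; ring
        _ ≤ t ^ d * Real.exp (b * (t / 2) ^ β) * ν t * (d * (1 + t ^ β) + b * (1 + t ^ β)) := by
            gcongr
        _ = _ := by ring
  obtain ⟨g, hg1, hg2, hg3⟩ := hmaj
  refine ⟨g, hg1, hg2, hg3.trans (le_of_eq ?_)⟩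
  have : 0 < r ^ α₃ := by positivity
  rw [Real.rpow_neg hr.le, hK]
  field_simp

end NuAssumptions

/-- A radial integral over `{|y| > r}` is controlled through a one-dimensional majorant. -/
lemma setIntegral_norm_gt_le (n : ℕ) (hn : 0 < n) {G g : ℝ → ℝ} {r M B : ℝ} (hr : 0 < r)
    (hM : 0 ≤ M) (hG0 : ∀ t, r < t → 0 ≤ G t) (hG : ∀ t, r < t → t ^ (n - 1) * G t ≤ M * g t)
    (hg : IntegrableOn g (Ioi r)) (hB : ∫ t in Ioi r, g t ≤ B) :
    ∫ y in {y : EuclideanSpace ℝ (Fin n) | r < ‖y‖}, G ‖y‖ ≤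
      (n * volume.real (Metric.ball (0 : EuclideanSpace ℝ (Fin n)) 1)) * (M * B) := by
  rw [setIntegral_norm_gt n hn G hr]
  gcongr
  calc ∫ t in Ioi r, t ^ (n - 1) * G t ≤ ∫ t in Ioi r, M * g t := by
        refine integral_mono_of_nonneg ?_ (hg.const_mul M) ?_
        · filter_upwards [ae_restrict_mem measurableSet_Ioi] with t ht
          exact mul_nonneg (pow_nonneg (hr.trans ht).le _) (hG0 t ht)
        · filter_upwards [ae_restrict_mem measurableSet_Ioi] with t ht
          exact hG t ht
    _ ≤ M * B := by rw [integral_const_mul]; gcongr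

/-- condition (P): tail convolution bounds for f̃, ν and f, ν₁. -/
theorem condition_P (d : ℕ) (hd : 0 < d) (ν : ℝ → ℝ) (a b β ℓ a₃ α₃ : ℝ)
    (H : NuAssumptions d ν a b β ℓ a₃ α₃) :
    ∃ c : ℝ, 0 < c ∧ ∀ r s : ℝ, 0 < r → 0 < s →
      (∫ y in {y : EuclideanSpace ℝ (Fin d) | r < ‖y‖},
          ftil d ν b β ℓ (max s ‖y‖ - ‖y‖ / 2) * ν ‖y‖)
        ≤ c * ftil d ν b β ℓ s * Psi d hd ν (1 / r)
      ∧ (∫ y in {y : EuclideanSpace ℝ (Fin (d + 2)) | r < ‖y‖},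
          ffun d ν b β ℓ (max s ‖y‖ - ‖y‖ / 2) * nu1 ν ‖y‖)
        ≤ c * ffun d ν b β ℓ s * Psi d hd ν (1 / r) := by
  obtain ⟨hpos₁, C₁, hC₁, hle₁⟩ := H.exists_phiHat_profile_le hd d H.ℓ_nonneg
    (F := ftil d ν b β ℓ) fun x => rfl
  obtain ⟨hpos₂, C₂, hC₂, hle₂⟩ := H.exists_phiHat_profile_le hd (d + 1) (p := ℓ + 1)
    (by linarith [H.ℓ_nonneg]) (F := ffun d ν b β ℓ) fun x => by
      rw [ffun, show -(ℓ + 1) = -ℓ - 1 by ring]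
  obtain ⟨K₁, hK₁, hmaj₁⟩ := H.exists_setIntegral_weight_nu_le hd
  obtain ⟨K₂, hK₂, hmaj₂⟩ := H.exists_setIntegral_weight_neg_deriv_le hd
  obtain ⟨c, hc, hΨ⟩ := H.exists_div_phiHat_le_Psi hd
  set V₁ := d * volume.real (Metric.ball (0 : EuclideanSpace ℝ (Fin d)) 1)
  set V₂ := (d + 2 : ℕ) * volume.real (Metric.ball (0 : EuclideanSpace ℝ (Fin (d + 2))) 1)
  have hV₁ : 0 ≤ V₁ := by positivity
  have hV₂ : 0 ≤ V₂ := by positivity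
  refine ⟨(V₁ * C₁ * K₁ + V₂ * C₂ * K₂ + 1) / c, by positivity, fun r s hr hs => ?_⟩
  have hφ := H.phiHat_pos hd hr
  have key : ∀ {V C K A : ℝ}, 0 < A → V * C * K ≤ V₁ * C₁ * K₁ + V₂ * C₂ * K₂ + 1 →
      V * (C * A * (K / phiHat d ν r)) ≤
        (V₁ * C₁ * K₁ + V₂ * C₂ * K₂ + 1) / c * A * Psi d hd ν (1 / r) := by
    intro V C K A hA hVCK
    calc V * (C * A * (K / phiHat d ν r)) = V * C * K * (A / phiHat d ν r) := by ring
      _ ≤ (V₁ * C₁ * K₁ + V₂ * C₂ * K₂ + 1) * (A / phiHat d ν r) := by gcongr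
      _ = (V₁ * C₁ * K₁ + V₂ * C₂ * K₂ + 1) / c * A * (c / phiHat d ν r) := by field_simp
      _ ≤ _ := by gcongr; exact hΨ r hr
  have hu : ∀ t, 0 < max s t - t / 2 := fun t => by
    rcases le_total t 0 with h | h
    · linarith [le_max_left s t]
    · linarith [le_max_left s t, le_max_right s t]
  have hle_add₁ : 0 ≤ V₁ * C₁ * K₁ := by positivity
  have hle_add₂ : 0 ≤ V₂ * C₂ * K₂ := by positivity
  constructor
  · obtain ⟨g, hg, hgle, hgint⟩ := hmaj₁ r hr
    have hfs := hpos₁ s hs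
    refine (setIntegral_norm_gt_le d hd
      (G := fun t => ftil d ν b β ℓ (max s t - t / 2) * ν t) hr (M := C₁ * ftil d ν b β ℓ s)
      (by positivity) (fun t ht => ?_) (fun t ht => ?_) hg hgint).trans
      (key hfs (by linarith))
    · exact mul_nonneg (hpos₁ _ (hu t)).le (H.ν_pos t (hr.trans ht)).le
    · have ht0 : 0 < t := hr.trans ht
      have hν := H.ν_pos t ht0
      calc t ^ (d - 1) * (ftil d ν b β ℓ (max s t - t / 2) * ν t)
          ≤ t ^ (d - 1) * (C₁ * ftil d ν b β ℓ s * Real.exp (b * (t / 2) ^ β) * ν t) := by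
            gcongr; exact hle₁ s t hs ht0
        _ = C₁ * ftil d ν b β ℓ s * (t ^ (d - 1) * (Real.exp (b * (t / 2) ^ β) * ν t)) := by ring
        _ ≤ _ := by gcongr; exact hgle t ht.le
  · obtain ⟨g, hg, hgle, hgint⟩ := hmaj₂ r hr
    have hfs := hpos₂ s hs
    refine (setIntegral_norm_gt_le (d + 2) (by omega)
      (G := fun t => ffun d ν b β ℓ (max s t - t / 2) * nu1 ν t) hr (M := C₂ * ffun d ν b β ℓ s)
      (by positivity) (fun t ht => ?_) (fun t ht => ?_) hg hgint).trans
      (key hfs (by linarith))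
    · have ht0 : 0 < t := hr.trans ht
      exact mul_nonneg (hpos₂ _ (hu t)).le
        (div_nonneg (neg_nonneg.2 (H.deriv_nonpos ht0)) (by positivity))
    · have ht0 : 0 < t := hr.trans ht
      have hν' : 0 ≤ -deriv ν t := neg_nonneg.2 (H.deriv_nonpos ht0)
      have hnu1 : t * nu1 ν t ≤ -deriv ν t := by
        have h1 : t * nu1 ν t = -deriv ν t / (2 * Real.pi) := by rw [nu1]; field_simp
        rw [h1]
        exact div_le_self hν' (by linarith [Real.pi_gt_three])
      have hf := (hpos₂ _ (hu t)).le
      calc t ^ (d + 2 - 1) * (ffun d ν b β ℓ (max s t - t / 2) * nu1 ν t)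
          = t ^ d * ffun d ν b β ℓ (max s t - t / 2) * (t * nu1 ν t) := by
            rw [show d + 2 - 1 = d + 1 by omega]; ring
        _ ≤ t ^ d * ffun d ν b β ℓ (max s t - t / 2) * -deriv ν t := by gcongr
        _ ≤ t ^ d * (C₂ * ffun d ν b β ℓ s * Real.exp (b * (t / 2) ^ β)) * -deriv ν t := by
            gcongr; exact hle₂ s t hs ht0
        _ = C₂ * ffun d ν b β ℓ s * (t ^ d * Real.exp (b * (t / 2) ^ β) * -deriv ν t) := by ring
        _ ≤ _ := by gcongr; exact hgle t ht.le
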